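/- Let j ≥ 1 be an integer and let 0 < x₁ < x₂ < ⋯ < x_j < L be points satisfying x₁ ≥ T_H(λ), x_i − x_{i−1} ≥ 2·T_H(λ) for 2 ≤ i ≤ j, and x_j ≤ L − T_H(λ). Then u(x) := Σ_{i=1}^{j} û_λ(x − x_i) is a nonnegative solution of the BVP, and u(x) > 0 if and only if x lies in the union of the intervals (x_i − T_H(λ), x_i + T_H(λ)). Moreover, points x₁ < ⋯ < x_j satisfying these conditions exist if and only if λ ≥ Σ_j(p) := (2/(1−p))²·(jπ/L)². -/

import Mathlib

/-- The extinction time `T_H(λ) = π/((1-p)·√λ)`. -/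
noncomputable def TH (p lam : ℝ) : ℝ := Real.pi / ((1 - p) * Real.sqrt lam)

/-- The maximum value `u_H(λ) = (2a/((p+1)λ))^{1/(1-p)}` of the degenerate homoclinic. -/
noncomputable def uH (a p lam : ℝ) : ℝ := (2 * a / ((p + 1) * lam)) ^ (1 / (1 - p))

/-- The degenerate homoclinic solution `û_λ`. -/
noncomputable def uhat (a p lam x : ℝ) : ℝ :=
  if |x| ≤ TH p lam then
    uH a p lam * Real.cos ((1 - p) * Real.sqrt lam * x / 2) ^ (2 / (1 - p))
  else 0

/-- A nonnegative solution of the boundary value problem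
`u'' + λu - a u^p = 0` in `[0,L]`, `u(0) = u(L) = 0`. -/
def IsNonnegSolution (a L p lam : ℝ) (u : ℝ → ℝ) : Prop :=
  ContDiffOn ℝ 2 u (Set.Icc 0 L) ∧
  (∀ x ∈ Set.Icc (0 : ℝ) L, 0 ≤ u x) ∧
  u 0 = 0 ∧ u L = 0 ∧
  ∀ x ∈ Set.Icc (0 : ℝ) L,
    iteratedDerivWithin 2 u (Set.Icc 0 L) x + lam * u x - a * u x ^ p = 0

/-- Admissibility of the bump locations `0 < x₁ < ⋯ < x_j < L` with
`x₁ ≥ T_H(λ)`, `x_i - x_{i-1} ≥ 2 T_H(λ)` and `x_j ≤ L - T_H(λ)`. -/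
def AdmissibleBumps (L p lam : ℝ) (j : ℕ) (hj : 0 < j) (x : Fin j → ℝ) : Prop :=
  StrictMono x ∧ (∀ i, 0 < x i ∧ x i < L) ∧
  TH p lam ≤ x ⟨0, hj⟩ ∧
  (∀ i : Fin j, ∀ hi : (i : ℕ) + 1 < j, 2 * TH p lam ≤ x ⟨(i : ℕ) + 1, hi⟩ - x i) ∧
  x ⟨j - 1, Nat.sub_lt hj Nat.one_pos⟩ ≤ L - TH p lam

/-- The cosine `cos (c x)` cut off outside `[-T, T]`. -/
noncomputable def cutCos (T c x : ℝ) : ℝ := if |x| ≤ T then Real.cos (c * x) else 0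

theorem contDiff_two_of_hasDerivAt {f f' f'' : ℝ → ℝ} (h1 : ∀ x, HasDerivAt f (f' x) x)
    (h2 : ∀ x, HasDerivAt f' (f'' x) x) (hc : Continuous f'') :
    ContDiff ℝ 2 f ∧ iteratedDeriv 2 f = f'' := by
  have e1 : deriv f = f' := funext fun x => (h1 x).deriv
  have e2 : deriv f' = f'' := funext fun x => (h2 x).deriv
  constructor
  · have : ContDiff ℝ (1 + 1) f := by
      rw [contDiff_succ_iff_deriv]
      refine ⟨fun x => (h1 x).differentiableAt, by simp, ?_⟩
      rw [e1, contDiff_one_iff_deriv, e2]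
      exact ⟨fun x => (h2 x).differentiableAt, hc⟩
    simpa [one_add_one_eq_two] using this
  · rw [iteratedDeriv_succ, iteratedDeriv_one, e1, e2]

theorem hasDerivAt_max_zero_rpow {r : ℝ} (hr : 1 < r) (y : ℝ) :
    HasDerivAt (fun y : ℝ => max y 0 ^ r) (r * max y 0 ^ (r - 1)) y := by
  have h0 : (0 : ℝ) ^ r = 0 := Real.zero_rpow (by linarith)
  have h0' : (0 : ℝ) ^ (r - 1) = 0 := Real.zero_rpow (by linarith)
  have hpos : ∀ z : ℝ, HasDerivAt (fun y : ℝ => y ^ r) (r * z ^ (r - 1)) z := fun z =>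
    Real.hasDerivAt_rpow_const (Or.inr hr.le)
  rcases lt_trichotomy y 0 with hy | rfl | hy
  · rw [max_eq_right hy.le, h0', mul_zero]
    refine (hasDerivAt_const y (0 : ℝ)).congr_of_eventuallyEq ?_
    filter_upwards [Iio_mem_nhds hy] with z hz
    rw [max_eq_right (le_of_lt hz), h0]
  · rw [max_self, h0', mul_zero, ← hasDerivWithinAt_univ, ← Set.Iic_union_Ici (a := (0 : ℝ))]
    refine HasDerivWithinAt.union ?_ ?_
    · refine (hasDerivWithinAt_const (0 : ℝ) _ (0 : ℝ)).congr (fun z hz => ?_) ?_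
      · rw [max_eq_right hz, h0]
      · rw [max_self, h0]
    · have h := (hpos 0).hasDerivWithinAt (s := Set.Ici 0)
      rw [h0', mul_zero] at h
      refine h.congr (fun z hz => ?_) ?_
      · rw [max_eq_left hz]
      · rw [max_self]
  · rw [max_eq_left hy.le]
    refine (hpos y).congr_of_eventuallyEq ?_
    filter_upwards [Ioi_mem_nhds hy] with z hz
    rw [max_eq_left (le_of_lt hz)]

section cutCos

variable {T c : ℝ}

theorem cutCos_of_le_abs (hcT : c * T = Real.pi / 2) {x : ℝ} (hx : T ≤ |x|) :
    cutCos T c x = 0 := by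
  unfold cutCos
  split_ifs with h
  · have hT : |x| = T := le_antisymm h hx
    rcases abs_choice x with h' | h'
    · rw [← h', hT, hcT, Real.cos_pi_div_two]
    · rw [← Real.cos_neg, ← mul_neg, ← h', hT, hcT, Real.cos_pi_div_two]
  · rfl

theorem cutCos_pos (hc : 0 < c) (hcT : c * T = Real.pi / 2) {x : ℝ} (hx : |x| < T) :
    0 < cutCos T c x := by
  rw [cutCos, if_pos hx.le]
  obtain ⟨h1, h2⟩ := abs_lt.1 hx
  apply Real.cos_pos_of_mem_Ioo
  constructor <;> nlinarith

theorem cutCos_pos_iff (hc : 0 < c) (hcT : c * T = Real.pi / 2) {x : ℝ} :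
    0 < cutCos T c x ↔ |x| < T := by
  refine ⟨fun h => ?_, cutCos_pos hc hcT⟩
  by_contra! hx
  exact h.ne' (cutCos_of_le_abs hcT hx)

theorem cutCos_nonneg (hc : 0 < c) (hcT : c * T = Real.pi / 2) (x : ℝ) : 0 ≤ cutCos T c x := by
  rcases lt_or_ge |x| T with hx | hx
  · exact (cutCos_pos hc hcT hx).le
  · exact (cutCos_of_le_abs hcT hx).ge

theorem cutCos_eq_max (hc : 0 < c) (hcT : c * T = Real.pi / 2) {x : ℝ} (hx : |x| < 3 * T) :
    cutCos T c x = max (Real.cos (c * x)) 0 := by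
  rcases lt_or_ge |x| T with h | h
  · have := cutCos_pos hc hcT h
    rw [cutCos, if_pos h.le] at this ⊢
    rw [max_eq_left this.le]
  · rw [cutCos_of_le_abs hcT h, max_eq_right]
    rw [← Real.cos_abs, abs_mul, abs_of_pos hc]
    apply Real.cos_nonpos_of_pi_div_two_le_of_le <;> nlinarith

theorem cutCos_mul_cos (x : ℝ) : cutCos T c x * Real.cos (c * x) = cutCos T c x ^ 2 := by
  unfold cutCos
  split_ifs <;> ring

theorem hasDerivAt_cutCos_rpow (hc : 0 < c) (hcT : c * T = Real.pi / 2) {r : ℝ} (hr : 1 < r)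
    (x : ℝ) : HasDerivAt (fun x => cutCos T c x ^ r)
      (-(r * c * (cutCos T c x ^ (r - 1) * Real.sin (c * x)))) x := by
  have hT : 0 < T := by
    have := Real.pi_pos
    by_contra! h
    nlinarith
  rcases lt_or_ge |x| (3 * T) with hx | hx
  · have h1 : HasDerivAt (fun x => Real.cos (c * x)) (-Real.sin (c * x) * c) x := by
      simpa using (((hasDerivAt_id x).const_mul c).cos)
    have h2 := (hasDerivAt_max_zero_rpow hr (Real.cos (c * x))).comp x h1
    rw [← cutCos_eq_max hc hcT hx] at h2
    have h3 := h2.congr_of_eventuallyEq (f₁ := fun x => cutCos T c x ^ r) (by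
      filter_upwards [(isOpen_lt continuous_abs continuous_const).mem_nhds hx] with z hz
      rw [cutCos_eq_max hc hcT hz, Function.comp_apply])
    refine h3.congr_deriv ?_
    ring
  · rw [cutCos_of_le_abs hcT (by linarith), Real.zero_rpow (by linarith)]
    simp only [zero_mul, mul_zero, neg_zero]
    refine (hasDerivAt_const x (0 : ℝ)).congr_of_eventuallyEq ?_
    have hx' : T < |x| := by linarith
    filter_upwards [(isOpen_lt continuous_const continuous_abs).mem_nhds hx'] with z hz
    rw [cutCos_of_le_abs hcT (le_of_lt hz), Real.zero_rpow (by linarith)]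

theorem continuous_cutCos (hcT : c * T = Real.pi / 2) : Continuous (cutCos T c) := by
  unfold cutCos
  refine Continuous.if_le (by fun_prop) continuous_const continuous_abs continuous_const ?_
  intro x hx
  have := cutCos_of_le_abs hcT hx.ge
  rwa [cutCos, if_pos hx.le] at this

theorem hasDerivAt_cutCos_rpow_mul_sin (hc : 0 < c) (hcT : c * T = Real.pi / 2) {q : ℝ}
    (hq : 2 < q) (x : ℝ) :
    HasDerivAt (fun x => -(q * c * (cutCos T c x ^ (q - 1) * Real.sin (c * x))))
      (q * c ^ 2 * ((q - 1) * cutCos T c x ^ (q - 2) - q * cutCos T c x ^ q)) x := by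
  have h1 : HasDerivAt (fun x => Real.sin (c * x)) (Real.cos (c * x) * c) x := by
    simpa using (((hasDerivAt_id x).const_mul c).sin)
  have h2 := (((hasDerivAt_cutCos_rpow hc hcT (r := q - 1) (by linarith) x).mul h1).const_mul
    (q * c)).neg
  refine h2.congr_deriv ?_
  have hw := cutCos_nonneg hc hcT x
  have hwc := cutCos_mul_cos (T := T) (c := c) x
  have hs := Real.sin_sq_add_cos_sq (c * x)
  rw [show q - 1 - 1 = q - 2 by ring]
  set w := cutCos T c x
  rcases hw.eq_or_lt with h0 | hpos
  · rw [← h0, Real.zero_rpow (by linarith), Real.zero_rpow (by linarith),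
      Real.zero_rpow (by linarith)]
    ring
  · have hcos : Real.cos (c * x) = w := by
      have : w * Real.cos (c * x) = w * w := by rw [hwc, sq]
      exact mul_left_cancel₀ hpos.ne' this
    have e1 : w ^ (q - 1) = w ^ (q - 2) * w := by
      rw [← Real.rpow_add_one hpos.ne']; congr 1; ring
    have e2 : w ^ q = w ^ (q - 2) * w ^ 2 := by
      rw [← Real.rpow_two, ← Real.rpow_add hpos]; congr 1; ring
    rw [e1, e2, hcos]
    rw [hcos] at hs
    linear_combination (q * c ^ 2 * (q - 1) * w ^ (q - 2)) * hs

end cutCos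

theorem sum_rpow_of_pairwise_zero {ι : Type*} [Fintype ι] {p : ℝ} (hp : p ≠ 0) (f : ι → ℝ)
    (h : ∀ i k, f i ≠ 0 → f k ≠ 0 → i = k) : (∑ i, f i) ^ p = ∑ i, f i ^ p := by
  by_cases hf : ∃ i, f i ≠ 0
  · obtain ⟨i, hi⟩ := hf
    have h0 : ∀ k, k ≠ i → f k = 0 := fun k hk => by
      by_contra hk'
      exact hk (h k i hk' hi)
    rw [Fintype.sum_eq_single i h0, Fintype.sum_eq_single i fun k hk => by
      rw [h0 k hk, Real.zero_rpow hp]]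
  · push Not at hf
    simp [hf, Real.zero_rpow hp]

section uhat

variable {a p lam : ℝ}

theorem TH_pos (hp1 : p < 1) (hlam : 0 < lam) : 0 < TH p lam :=
  div_pos Real.pi_pos (mul_pos (by linarith) (Real.sqrt_pos.2 hlam))

theorem rate_mul_TH (hp1 : p < 1) (hlam : 0 < lam) :
    (1 - p) * Real.sqrt lam / 2 * TH p lam = Real.pi / 2 := by
  have h1 : 1 - p ≠ 0 := by linarith
  have h2 := (Real.sqrt_pos.2 hlam).ne'
  unfold TH
  field_simp

theorem uhat_eq (hp1 : p < 1) (x : ℝ) : uhat a p lam x =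
    uH a p lam * cutCos (TH p lam) ((1 - p) * Real.sqrt lam / 2) x ^ (2 / (1 - p)) := by
  have hq : (2 / (1 - p)) ≠ 0 := (div_pos two_pos (by linarith)).ne'
  unfold uhat cutCos
  split_ifs
  · rw [show (1 - p) * Real.sqrt lam / 2 * x = (1 - p) * Real.sqrt lam * x / 2 by ring]
  · rw [Real.zero_rpow hq, mul_zero]

theorem uH_pos (ha : 0 < a) (hp0 : 0 < p) (hlam : 0 < lam) : 0 < uH a p lam :=
  Real.rpow_pos_of_pos (by positivity) _

theorem uH_rpow (ha : 0 < a) (hp0 : 0 < p) (hp1 : p < 1) (hlam : 0 < lam) :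
    lam * ((p + 1) / 2) * uH a p lam = a * uH a p lam ^ p := by
  have hU := uH_pos ha hp0 hlam
  have h : uH a p lam ^ (1 - p) = 2 * a / ((p + 1) * lam) := by
    unfold uH
    rw [← Real.rpow_mul (by positivity), one_div_mul_cancel (by linarith), Real.rpow_one]
  have h' : uH a p lam = uH a p lam ^ (1 - p) * uH a p lam ^ p := by
    rw [← Real.rpow_add hU]; simp
  calc lam * ((p + 1) / 2) * uH a p lam
      = lam * ((p + 1) / 2) * (uH a p lam ^ (1 - p) * uH a p lam ^ p) := by rw [← h']
    _ = a * uH a p lam ^ p := by rw [h]; field_simp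

theorem uhat_nonneg (ha : 0 < a) (hp0 : 0 < p) (hp1 : p < 1) (hlam : 0 < lam) (x : ℝ) :
    0 ≤ uhat a p lam x := by
  rw [uhat_eq hp1]
  have hc : 0 < (1 - p) * Real.sqrt lam / 2 :=
    half_pos (mul_pos (by linarith) (Real.sqrt_pos.2 hlam))
  exact mul_nonneg (uH_pos ha hp0 hlam).le
    (Real.rpow_nonneg (cutCos_nonneg hc (rate_mul_TH hp1 hlam) x) _)

theorem uhat_pos_iff (ha : 0 < a) (hp0 : 0 < p) (hp1 : p < 1) (hlam : 0 < lam) (x : ℝ) :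
    0 < uhat a p lam x ↔ |x| < TH p lam := by
  have hc : 0 < (1 - p) * Real.sqrt lam / 2 :=
    half_pos (mul_pos (by linarith) (Real.sqrt_pos.2 hlam))
  have hq : 0 < 2 / (1 - p) := div_pos two_pos (by linarith)
  rw [uhat_eq hp1, mul_pos_iff_of_pos_left (uH_pos ha hp0 hlam),
    ← cutCos_pos_iff hc (rate_mul_TH hp1 hlam)]
  refine ⟨fun h => ?_, fun h => Real.rpow_pos_of_pos h _⟩
  refine (cutCos_nonneg hc (rate_mul_TH hp1 hlam) x).lt_of_ne fun h0 => ?_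
  rw [← h0, Real.zero_rpow hq.ne'] at h
  exact h.false

theorem uhat_ne_zero_iff (ha : 0 < a) (hp0 : 0 < p) (hp1 : p < 1) (hlam : 0 < lam) (x : ℝ) :
    uhat a p lam x ≠ 0 ↔ |x| < TH p lam := by
  rw [← uhat_pos_iff ha hp0 hp1 hlam]
  exact (uhat_nonneg ha hp0 hp1 hlam x).lt_iff_ne'.symm

theorem contDiff_uhat (ha : 0 < a) (hp0 : 0 < p) (hp1 : p < 1) (hlam : 0 < lam) :
    ContDiff ℝ 2 (uhat a p lam) ∧ iteratedDeriv 2 (uhat a p lam) =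
      fun x => a * uhat a p lam x ^ p - lam * uhat a p lam x := by
  have hp1' : 0 < 1 - p := by linarith
  have hc : 0 < (1 - p) * Real.sqrt lam / 2 :=
    half_pos (mul_pos hp1' (Real.sqrt_pos.2 hlam))
  have hcT := rate_mul_TH hp1 hlam
  have hq : 2 < 2 / (1 - p) := by rw [lt_div_iff₀ hp1']; linarith
  have hU := uH_rpow ha hp0 hp1 hlam
  have hqp : 2 / (1 - p) * p = 2 / (1 - p) - 2 := by field_simp; ring
  have hqc : (2 / (1 - p)) ^ 2 * ((1 - p) * Real.sqrt lam / 2) ^ 2 = lam := by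
    have := Real.sq_sqrt hlam.le
    field_simp
    exact this
  have hqc' : (2 / (1 - p)) * ((1 - p) * Real.sqrt lam / 2) ^ 2 * (2 / (1 - p) - 1)
      = lam * ((p + 1) / 2) := by
    have := Real.sq_sqrt hlam.le
    field_simp
    rw [this]
    ring
  have hUpos := uH_pos ha hp0 hlam
  rw [funext fun x => uhat_eq (a := a) (lam := lam) hp1 x]
  set q := 2 / (1 - p)
  set c := (1 - p) * Real.sqrt lam / 2
  set U := uH a p lam
  have hcont := continuous_cutCos hcT
  obtain ⟨h1, h2⟩ := contDiff_two_of_hasDerivAt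
    (fun x => (hasDerivAt_cutCos_rpow hc hcT (by linarith : 1 < q) x).const_mul U)
    (fun x => (hasDerivAt_cutCos_rpow_mul_sin hc hcT hq x).const_mul U)
    (continuous_const.mul (continuous_const.mul
      ((continuous_const.mul (hcont.rpow_const fun _ => Or.inr (by linarith))).sub
      (continuous_const.mul (hcont.rpow_const fun _ => Or.inr (by linarith))))))
  refine ⟨h1, h2.trans (funext fun x => ?_)⟩
  have hw := cutCos_nonneg hc hcT x
  dsimp only
  rw [Real.mul_rpow hUpos.le (Real.rpow_nonneg hw _), ← Real.rpow_mul hw, hqp]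
  linear_combination U * cutCos (TH p lam) c x ^ (q - 2) * hqc'
    - U * cutCos (TH p lam) c x ^ q * hqc + cutCos (TH p lam) c x ^ (q - 2) * hU

end uhat

section AdmissibleBumps

variable {L p lam : ℝ} {j : ℕ} {hj : 0 < j} {x : Fin j → ℝ}

theorem AdmissibleBumps.two_mul_TH_le (h : AdmissibleBumps L p lam j hj x) {i k : Fin j}
    (hik : i < k) : 2 * TH p lam ≤ x k - x i := by
  obtain ⟨hmono, -, -, hgap, -⟩ := h
  have hi : (i : ℕ) + 1 < j := lt_of_le_of_lt hik k.2
  have h1 := hgap i hi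
  have h2 : x ⟨(i : ℕ) + 1, hi⟩ ≤ x k := hmono.monotone (Fin.mk_le_of_le_val hik)
  linarith

theorem AdmissibleBumps.TH_le (h : AdmissibleBumps L p lam j hj x) (i : Fin j) :
    TH p lam ≤ x i :=
  h.2.2.1.trans (h.1.monotone (Fin.mk_le_of_le_val (Nat.zero_le _)))

theorem AdmissibleBumps.le_sub_TH (h : AdmissibleBumps L p lam j hj x) (i : Fin j) :
    x i ≤ L - TH p lam :=
  (h.1.monotone (Fin.le_def.2 (Nat.le_sub_one_of_lt i.2))).trans h.2.2.2.2

theorem exists_admissibleBumps_iff (hp1 : p < 1) (hlam : 0 < lam) :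
    (∃ x : Fin j → ℝ, AdmissibleBumps L p lam j hj x) ↔ 2 * j * TH p lam ≤ L := by
  have hT := TH_pos hp1 hlam
  constructor
  · rintro ⟨x, -, -, h0, hgap, hlast⟩
    have key : ∀ n : ℕ, ∀ hn : n < j, (2 * n + 1) * TH p lam ≤ x ⟨n, hn⟩ := by
      intro n
      induction n with
      | zero => intro hn; simpa using h0
      | succ n ih =>
        intro hn
        have h1 := ih (by omega)
        have h2 := hgap ⟨n, by omega⟩ hn
        push_cast
        linarith
    have := key (j - 1) (Nat.sub_lt hj Nat.one_pos)
    rw [Nat.cast_sub hj] at this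
    push_cast at this
    linarith
  · intro h
    have hle : ∀ i : Fin j, (2 * (i : ℕ) + 1) * TH p lam ≤ L - TH p lam := by
      intro i
      have : ((i : ℕ) : ℝ) + 1 ≤ j := by exact_mod_cast i.2
      nlinarith
    refine ⟨fun i => (2 * (i : ℕ) + 1) * TH p lam, ?_, fun i => ⟨by positivity, ?_⟩, ?_, ?_, ?_⟩
    · intro i k hik
      have : ((i : ℕ) : ℝ) < (k : ℕ) := by exact_mod_cast hik
      dsimp only
      gcongr
    · have := hle i
      linarith
    · simp
    · intro i hi
      push_cast
      linarith
    · exact hle _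

theorem two_mul_TH_le_iff (hL : 0 < L) (hp1 : p < 1) (hlam : 0 < lam) :
    2 * j * TH p lam ≤ L ↔ (2 / (1 - p)) ^ 2 * ((j : ℝ) * Real.pi / L) ^ 2 ≤ lam := by
  have hp1' : 0 < 1 - p := by linarith
  have hs := Real.sqrt_pos.2 hlam
  have hr : 0 ≤ 2 / (1 - p) * (j * Real.pi / L) := by
    have := Real.pi_pos
    positivity
  rw [← mul_pow, ← Real.le_sqrt hr hlam.le, TH, ← mul_div_assoc, div_le_iff₀ (by positivity),
    div_mul_div_comm, div_le_iff₀ (by positivity)]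
  constructor <;> intro h <;> linarith

theorem AdmissibleBumps.isNonnegSolution {a : ℝ} (ha : 0 < a) (hL : 0 < L) (hp0 : 0 < p)
    (hp1 : p < 1) (hlam : 0 < lam) (h : AdmissibleBumps L p lam j hj x) :
    IsNonnegSolution a L p lam (fun t => ∑ i, uhat a p lam (t - x i)) := by
  obtain ⟨hC, hD⟩ := contDiff_uhat ha hp0 hp1 hlam
  have hCi : ∀ i, ContDiff ℝ 2 fun t => uhat a p lam (t - x i) := fun i =>
    hC.comp (contDiff_id.sub contDiff_const)
  have hsum : ContDiff ℝ 2 fun t => ∑ i, uhat a p lam (t - x i) :=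
    ContDiff.sum fun i _ => hCi i
  have hzero : ∀ y, TH p lam ≤ |y| → uhat a p lam y = 0 := fun y hy => by
    by_contra h'
    exact absurd ((uhat_ne_zero_iff ha hp0 hp1 hlam y).1 h') (not_lt.2 hy)
  refine ⟨hsum.contDiffOn, fun t _ => Finset.sum_nonneg fun i _ =>
    uhat_nonneg ha hp0 hp1 hlam _, ?_, ?_, ?_⟩
  · refine Finset.sum_eq_zero fun i _ => hzero _ ?_
    rw [zero_sub, abs_neg]
    exact (h.TH_le i).trans (le_abs_self _)
  · refine Finset.sum_eq_zero fun i _ => hzero _ ?_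
    exact le_trans (by linarith [h.le_sub_TH i]) (le_abs_self _)
  · intro t ht
    have hdisj : ∀ i k, uhat a p lam (t - x i) ≠ 0 → uhat a p lam (t - x k) ≠ 0 → i = k := by
      intro i k hi hk
      rw [uhat_ne_zero_iff ha hp0 hp1 hlam, abs_lt] at hi hk
      rcases lt_trichotomy i k with hik | hik | hik
      · linarith [h.two_mul_TH_le hik]
      · exact hik
      · linarith [h.two_mul_TH_le hik]
    rw [iteratedDerivWithin_eq_iteratedDeriv (uniqueDiffOn_Icc hL) hsum.contDiffAt ht,
      iteratedDeriv_fun_sum fun i _ => (hCi i).contDiffAt,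
      sum_rpow_of_pairwise_zero hp0.ne' _ hdisj, Finset.mul_sum, Finset.mul_sum,
      ← Finset.sum_add_distrib, ← Finset.sum_sub_distrib]
    refine Finset.sum_eq_zero fun i _ => ?_
    rw [iteratedDeriv_comp_sub_const, hD]
    ring

theorem sum_uhat_pos_iff {a : ℝ} (ha : 0 < a) (hp0 : 0 < p) (hp1 : p < 1) (hlam : 0 < lam)
    (t : ℝ) : 0 < ∑ i, uhat a p lam (t - x i) ↔
      ∃ i, t ∈ Set.Ioo (x i - TH p lam) (x i + TH p lam) := by
  rw [Finset.sum_pos_iff_of_nonneg fun i _ => uhat_nonneg ha hp0 hp1 hlam _]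
  refine exists_congr fun i => ?_
  rw [uhat_pos_iff ha hp0 hp1 hlam, abs_lt, Set.mem_Ioo]
  constructor
  · rintro ⟨-, h1, h2⟩
    constructor <;> linarith
  · rintro ⟨h1, h2⟩
    refine ⟨Finset.mem_univ _, ?_, ?_⟩ <;> linarith

end AdmissibleBumps

theorem stmt5 (a L p lam : ℝ) (ha : 0 < a) (hL : 0 < L) (hp0 : 0 < p) (hp1 : p < 1)
    (hlam : 0 < lam) (j : ℕ) (hj : 0 < j) :
    (∀ x : Fin j → ℝ, AdmissibleBumps L p lam j hj x →
      IsNonnegSolution a L p lam (fun t => ∑ i, uhat a p lam (t - x i)) ∧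
      ∀ t ∈ Set.Icc (0 : ℝ) L,
        (0 < ∑ i, uhat a p lam (t - x i) ↔
          ∃ i, t ∈ Set.Ioo (x i - TH p lam) (x i + TH p lam))) ∧
    ((∃ x : Fin j → ℝ, AdmissibleBumps L p lam j hj x) ↔
      (2 / (1 - p)) ^ 2 * ((j : ℝ) * Real.pi / L) ^ 2 ≤ lam) := by
  exact ⟨fun x hx => ⟨hx.isNonnegSolution ha hL hp0 hp1 hlam, fun t _ =>
    sum_uhat_pos_iff ha hp0 hp1 hlam t⟩,
    (exists_admissibleBumps_iff hp1 hlam).trans (two_mul_TH_le_iff hL hp1 hlam)⟩
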